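/- Let p ≡ 1 (mod 4) be a prime and let ε > 0, τ > 0. Suppose the Paley ETF Φ_p has the (p^{1/2+ε}, p^{−τ})-RIP. Then every clique S of the Paley graph G_p with |S| ≤ p^{1/2+ε} satisfies |S| ≤ p^{1/2−τ} + 1. -/

import Mathlib

open scoped Classical
open Finset

noncomputable section

/-- The quadratic character `χ` of `F_p`: `χ 0 = 0`, `χ x = 1` if `x` is a nonzero square,
and `χ x = -1` otherwise. -/
def quadChar (p : ℕ) (x : ZMod p) : ℤ :=
  if x = 0 then 0 else if IsSquare x then 1 else -1

/-- The canonical additive character `ψ` of `F_p`, `ψ x = exp(2πi·x/p)`. -/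
def addChar' (p : ℕ) (x : ZMod p) : ℂ :=
  Complex.exp (2 * Real.pi * Complex.I * (x.val : ℂ) / (p : ℂ))

/-- The set of quadratic residues mod `p` (nonzero squares), as a type. -/
abbrev QRes (p : ℕ) : Type := {b : ZMod p // b ≠ 0 ∧ IsSquare b}

/-- The Paley ETF: rows indexed by `{0} ∪ Q_p` (with `none` the `0`-row),
columns indexed by `F_p ∪ {∞}` (with `none` the `∞`-column). -/
def PaleyETF (p : ℕ) : Matrix (Option (QRes p)) (Option (ZMod p)) ℂ :=
  fun r c =>
    match r, c with
    | none, none => 1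
    | none, some _ => ((1 / Real.sqrt p : ℝ) : ℂ)
    | some _, none => 0
    | some b, some a => ((Real.sqrt (2 / p) : ℝ) : ℂ) * addChar' p (b.1 * a)

/-- `(K, δ)`-restricted isometry property for a complex matrix: for every vector `x`
with at most `K` nonzero entries, `(1-δ)‖x‖² ≤ ‖Φx‖² ≤ (1+δ)‖x‖²`. -/
def HasRIP {M N : Type*} [Fintype M] [Fintype N] (Φ : Matrix M N ℂ) (K δ : ℝ) : Prop :=
  ∀ x : N → ℂ, ((Finset.univ.filter fun n => x n ≠ 0).card : ℝ) ≤ K →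
    (1 - δ) * ∑ n, ‖x n‖ ^ 2 ≤ ∑ m, ‖∑ n, Φ m n * x n‖ ^ 2 ∧
      ∑ m, ‖∑ n, Φ m n * x n‖ ^ 2 ≤ (1 + δ) * ∑ n, ‖x n‖ ^ 2

/-- The Paley graph extractor: `Ext_p(x,y) = 1` if `x = y`, and `(χ(x−y)+1)/2` otherwise
(which is `1` iff `x − y` is a nonzero square, `0` otherwise). -/
def paleyExt (p : ℕ) (x y : ZMod p) : ℕ :=
  if x = y then 1 else if IsSquare (x - y) then 1 else 0

/-- Indicator vector of `U ⊆ F_p` with respect to the column indexing of the Paley ETF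
(entry `0` in the `∞` coordinate). -/
def indic (p : ℕ) (U : Finset (ZMod p)) : Option (ZMod p) → ℂ :=
  fun c => match c with
  | none => 0
  | some a => if a ∈ U then 1 else 0

/-- The quadratic character of `F_p` with complex values. -/
def complexQuadChar (p : ℕ) [Fact p.Prime] : MulChar (ZMod p) ℂ :=
  (quadraticChar (ZMod p)).ringHomComp (Int.castRingHom ℂ)

lemma complexQuadChar_apply (p : ℕ) [Fact p.Prime] (b : ZMod p) :
    complexQuadChar p b = ((quadraticChar (ZMod p) b : ℤ) : ℂ) := rfl

lemma addChar'_eq_stdAddChar (p : ℕ) [Fact p.Prime] (x : ZMod p) :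
    addChar' p x = ZMod.stdAddChar x := by
  rw [ZMod.stdAddChar_apply, ZMod.toCircle_apply]
  rfl

lemma ringChar_zmod_ne_two {p : ℕ} (hp4 : p % 4 = 1) : ringChar (ZMod p) ≠ 2 := by
  rw [ZMod.ringChar_zmod_n]
  omega

lemma complexQuadChar_ne_one {p : ℕ} [Fact p.Prime] (hp4 : p % 4 = 1) :
    complexQuadChar p ≠ 1 := by
  intro h
  obtain ⟨a, ha⟩ := quadraticChar_exists_neg_one (ringChar_zmod_ne_two hp4)
  have ha0 : a ≠ 0 := by
    rintro rfl
    simp at ha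
  have h1 : complexQuadChar p a = 1 := by
    rw [h, MulChar.one_apply (isUnit_iff_ne_zero.mpr ha0)]
  rw [complexQuadChar_apply, ha] at h1
  norm_num at h1

/-- For `p ≡ 1 (mod 4)` the quadratic Gauss sum is `±√p`. -/
lemma gaussSum_complexQuadChar {p : ℕ} [Fact p.Prime] (hp4 : p % 4 = 1) :
    ∃ g : ℝ, |g| = Real.sqrt p ∧ gaussSum (complexQuadChar p) ZMod.stdAddChar = (g : ℂ) := by
  have hsq : gaussSum (complexQuadChar p) ZMod.stdAddChar ^ 2 = ((Real.sqrt p : ℝ) : ℂ) ^ 2 := by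
    have hquad : (complexQuadChar p).IsQuadratic := (quadraticChar_isQuadratic (ZMod p)).comp _
    rw [gaussSum_sq (χ := complexQuadChar p) (complexQuadChar_ne_one hp4) hquad
      (ZMod.isPrimitive_stdAddChar p)]
    have h1 : quadraticChar (ZMod p) (-1) = 1 := by
      rw [quadraticChar_one_iff_isSquare (by simp)]
      exact ZMod.exists_sq_eq_neg_one_iff.mpr (by omega)
    rw [complexQuadChar_apply, h1, ZMod.card, ← Complex.ofReal_pow, Real.sq_sqrt (by positivity)]
    simp
  rcases sq_eq_sq_iff_eq_or_eq_neg.mp hsq with h | h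
  · exact ⟨Real.sqrt p, abs_of_nonneg (Real.sqrt_nonneg _), h⟩
  · exact ⟨-Real.sqrt p, by rw [abs_neg, abs_of_nonneg (Real.sqrt_nonneg _)], by simpa using h⟩

lemma sum_one_add_complexQuadChar_mul {p : ℕ} [Fact p.Prime] (F : ZMod p → ℂ) :
    ∑ b, (1 + complexQuadChar p b) * F b = F 0 + 2 * ∑ b : QRes p, F b := by
  have hQ : ∑ b : QRes p, F b = ∑ b ∈ univ.filter (fun b : ZMod p => b ≠ 0 ∧ IsSquare b), F b :=
    (Finset.sum_subtype _ (fun b => by simp) F).symm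
  rw [hQ, Finset.sum_filter, Finset.mul_sum,
    ← Finset.sum_ite_eq' univ (0 : ZMod p) F |>.trans (if_pos (mem_univ _)),
    ← Finset.sum_add_distrib]
  refine Finset.sum_congr rfl fun b _ => ?_
  rw [complexQuadChar_apply]
  by_cases hb : b = 0
  · simp [hb]
  by_cases hs : IsSquare b
  · rw [(quadraticChar_one_iff_isSquare hb).mpr hs]
    simp only [hb, hs, Int.cast_one, if_false, ne_eq, not_false_eq_true, and_self, if_true]
    ring
  · rw [quadraticChar_neg_one_iff_not_isSquare.mpr hs]
    simp [hb, hs]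

lemma sum_one_add_complexQuadChar_mul_stdAddChar {p : ℕ} [Fact p.Prime] (hp4 : p % 4 = 1)
    {d : ZMod p} (hd : IsSquare d) :
    ∑ b, (1 + complexQuadChar p b) * ZMod.stdAddChar (b * d) =
      if d = 0 then (p : ℂ) else gaussSum (complexQuadChar p) ZMod.stdAddChar := by
  simp only [add_mul, one_mul, Finset.sum_add_distrib]
  have h1 := AddChar.sum_mulShift d (ZMod.isPrimitive_stdAddChar p)
  rw [h1]
  split_ifs with h0
  · simp [h0, MulChar.sum_eq_zero_of_ne_one (complexQuadChar_ne_one hp4)]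
  · have h2 := gaussSum_mulShift (complexQuadChar p) (ZMod.stdAddChar (N := p)) (Units.mk0 d h0)
    rw [Units.val_mk0, complexQuadChar_apply, (quadraticChar_one_iff_isSquare h0).mpr hd] at h2
    rw [← h2]
    simp [gaussSum, AddChar.mulShift_apply, mul_comm]

/-- The squared norm of `Φ_p 1_S` as a weighted exponential sum. -/
lemma sum_norm_sq_paleyETF_indic {p : ℕ} [Fact p.Prime] (S : Finset (ZMod p)) :
    ((∑ m, ‖∑ n, PaleyETF p m n * indic p S n‖ ^ 2 : ℝ) : ℂ) =
      (1 / p) * ∑ b, (1 + complexQuadChar p b) *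
        ((‖∑ a ∈ S, ZMod.stdAddChar (b * a)‖ ^ 2 : ℝ) : ℂ) := by
  have hp : (0 : ℝ) < p := by exact_mod_cast (Fact.out : p.Prime).pos
  rw [sum_one_add_complexQuadChar_mul, Fintype.sum_option]
  have h0 : ‖∑ n, PaleyETF p none n * indic p S n‖ ^ 2 =
      (1 / p) * ‖∑ a ∈ S, (ZMod.stdAddChar ((0 : ZMod p) * a) : ℂ)‖ ^ 2 := by
    simp only [Fintype.sum_option, PaleyETF, indic, mul_zero, zero_add, mul_ite, mul_one,
      Finset.sum_ite_mem, univ_inter, zero_mul, AddChar.map_zero_eq_one]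
    rw [Finset.sum_const, Finset.sum_const, nsmul_eq_mul, nsmul_eq_mul, norm_mul, norm_mul,
      mul_pow, mul_pow, Complex.norm_real, Real.norm_eq_abs, sq_abs, div_pow,
      Real.sq_sqrt hp.le]
    simp
    ring
  have hb (b : QRes p) : ‖∑ n, PaleyETF p (some b) n * indic p S n‖ ^ 2 =
      (2 / p) * ‖∑ a ∈ S, (ZMod.stdAddChar (b.1 * a) : ℂ)‖ ^ 2 := by
    simp only [Fintype.sum_option, PaleyETF, indic, mul_zero, zero_add, mul_ite, mul_one,
      Finset.sum_ite_mem, univ_inter, addChar'_eq_stdAddChar]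
    rw [← Finset.mul_sum, norm_mul, mul_pow, Complex.norm_real, Real.norm_eq_abs, sq_abs,
      Real.sq_sqrt (by positivity)]
  simp only [h0, hb]
  rw [← Finset.mul_sum]
  push_cast
  ring

lemma norm_sq_sum_stdAddChar {p : ℕ} [Fact p.Prime] (S : Finset (ZMod p)) (b : ZMod p) :
    ((‖∑ a ∈ S, (ZMod.stdAddChar (b * a) : ℂ)‖ ^ 2 : ℝ) : ℂ) =
      ∑ a ∈ S, ∑ a' ∈ S, ZMod.stdAddChar (b * (a - a')) := by
  rw [Complex.ofReal_pow, ← Complex.mul_conj', map_sum, Finset.sum_mul_sum]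
  refine Finset.sum_congr rfl fun a _ => Finset.sum_congr rfl fun a' _ => ?_
  rw [← AddChar.map_neg_eq_conj, ← AddChar.map_add_eq_mul]
  congr 1
  ring

/-- On a clique `S` of the Paley graph, `‖Φ_p 1_S‖²` is determined by `|S|` and the Gauss sum. -/
lemma sum_norm_sq_paleyETF_indic_of_clique {p : ℕ} [Fact p.Prime] (hp4 : p % 4 = 1) {g : ℝ}
    (hg : gaussSum (complexQuadChar p) ZMod.stdAddChar = (g : ℂ))
    (S : Finset (ZMod p)) (hclique : ∀ x ∈ S, ∀ y ∈ S, x ≠ y → IsSquare (x - y)) :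
    ∑ m, ‖∑ n, PaleyETF p m n * indic p S n‖ ^ 2 =
      S.card + S.card * ((S.card : ℝ) - 1) * (g / p) := by
  have hp : (p : ℂ) ≠ 0 := by exact_mod_cast (Fact.out : p.Prime).ne_zero
  have key : ∑ b, (1 + complexQuadChar p b) *
      ((‖∑ a ∈ S, ZMod.stdAddChar (b * a)‖ ^ 2 : ℝ) : ℂ) =
      S.card * p + S.card * ((S.card : ℂ) - 1) * g := by
    simp only [norm_sq_sum_stdAddChar, Finset.mul_sum]
    rw [Finset.sum_comm]
    have hrow : ∀ a ∈ S, ∑ b, ∑ a' ∈ S,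
        (1 + complexQuadChar p b) * (ZMod.stdAddChar (b * (a - a')) : ℂ) =
        p + ((S.card : ℂ) - 1) * g := by
      intro a ha
      rw [Finset.sum_comm, ← Finset.add_sum_erase S _ ha,
        sum_one_add_complexQuadChar_mul_stdAddChar hp4 (by simp), if_pos (sub_self a),
        Finset.sum_congr rfl (g := fun _ => (g : ℂ)), Finset.sum_const, Finset.card_erase_of_mem ha,
        nsmul_eq_mul, Nat.cast_pred (Finset.card_pos.mpr ⟨a, ha⟩)]
      intro a' ha'
      obtain ⟨hne, ha'⟩ := Finset.mem_erase.mp ha'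
      rw [sum_one_add_complexQuadChar_mul_stdAddChar hp4 (hclique a ha a' ha' hne.symm),
        if_neg (sub_ne_zero.mpr hne.symm), hg]
    rw [Finset.sum_congr rfl hrow, Finset.sum_const, nsmul_eq_mul]
    ring
  have h := sum_norm_sq_paleyETF_indic S
  rw [key] at h
  apply Complex.ofReal_injective
  rw [h]
  push_cast
  field_simp

/-- **RIP bounds Paley graph cliques.** If `Φ_p` has the `(p^{1/2+ε}, p^{−τ})`-RIP, then
every clique `S` of the Paley graph `G_p` with `|S| ≤ p^{1/2+ε}` satisfies
`|S| ≤ p^{1/2−τ} + 1`. A clique is a set of pairwise adjacent vertices, adjacency being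
`x ≠ y` and `x − y` a nonzero square. -/
theorem paley_rip_clique_bound (p : ℕ) [Fact p.Prime] (hp4 : p % 4 = 1)
    (ε τ : ℝ) (hε : 0 < ε) (hτ : 0 < τ)
    (hRIP : HasRIP (PaleyETF p) ((p : ℝ) ^ ((1 : ℝ) / 2 + ε)) ((p : ℝ) ^ (-τ)))
    (S : Finset (ZMod p)) (hclique : ∀ x ∈ S, ∀ y ∈ S, x ≠ y → IsSquare (x - y))
    (hcard : (S.card : ℝ) ≤ (p : ℝ) ^ ((1 : ℝ) / 2 + ε)) :
    (S.card : ℝ) ≤ (p : ℝ) ^ ((1 : ℝ) / 2 - τ) + 1 := by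
  have hp : (0 : ℝ) < p := by exact_mod_cast (Fact.out : p.Prime).pos
  obtain ⟨g, hgabs, hg⟩ := gaussSum_complexQuadChar hp4
  have hsupp : (univ.filter fun n => indic p S n ≠ 0) = S.map Function.Embedding.some := by
    ext n
    rw [Finset.mem_filter]
    cases n <;> simp [indic]
  have hnorm : ∑ n, ‖indic p S n‖ ^ 2 = (S.card : ℝ) := by
    simp [Fintype.sum_option, indic, apply_ite]
  obtain ⟨hlo, hhi⟩ := hRIP (indic p S) (by rwa [hsupp, Finset.card_map])
  rw [sum_norm_sq_paleyETF_indic_of_clique hp4 hg S hclique, hnorm] at hlo hhi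
  rcases S.eq_empty_or_nonempty with rfl | hS
  · simp only [Finset.card_empty, Nat.cast_zero]
    positivity
  have hk : (1 : ℝ) ≤ S.card := by exact_mod_cast hS.card_pos
  have hk0 : (0 : ℝ) < S.card := by linarith
  have hbound : |((S.card : ℝ) - 1) * (g / p)| ≤ (p : ℝ) ^ (-τ) := by
    rw [abs_le]
    constructor <;> refine le_of_mul_le_mul_left ?_ hk0 <;> linarith
  have hroot : (p : ℝ) ^ ((1 : ℝ) / 2 - τ) = Real.sqrt p * (p : ℝ) ^ (-τ) := by
    rw [sub_eq_add_neg, Real.rpow_add hp, Real.sqrt_eq_rpow]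
  rw [abs_mul, abs_of_nonneg (sub_nonneg.mpr hk), abs_div, hgabs, abs_of_pos hp,
    Real.sqrt_div_self', mul_one_div, div_le_iff₀ (Real.sqrt_pos.mpr hp)] at hbound
  rw [hroot]
  linarith
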